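/- Every p-DG module over (A, D) is acyclic: if M is any module over the k-algebra E = End_k(A), then for every integer j with 1 ≤ j ≤ p-1, the kernel of the k-linear endomorphism of M given by the action of the element D^j ∈ E equals the image of the endomorphism given by the action of D^{p-j} ∈ E. -/

import Mathlib

open Polynomial

noncomputable section

/-- The truncated polynomial algebra `A = k[X]/(X^p)`. -/
abbrev TruncPoly (k : Type*) [Field k] (p : ℕ) : Type _ :=
  Polynomial k ⧸ Ideal.span {(Polynomial.X : Polynomial k) ^ p}

/-- The image `x` of the variable `X` in `A = k[X]/(X^p)`. -/
def truncX (k : Type*) [Field k] (p : ℕ) : TruncPoly k p :=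
  Ideal.Quotient.mk _ Polynomial.X

section Chain

variable {R V : Type*} [CommSemiring R] [AddCommMonoid V] [Module R V]
  {p : ℕ} {D J : Module.End R V} {e : ℕ → V}

theorem pow_apply_chain_add (hDS : ∀ i, i + 1 < p → D (e (i + 1)) = e i)
    (n i : ℕ) (h : i + n < p) : (D ^ n) (e (i + n)) = e i := by
  induction n with
  | zero => simp
  | succ n ih =>
    rw [pow_succ, Module.End.mul_apply, ← add_assoc, hDS _ (by omega), ih (by omega)]

theorem pow_apply_chain_eq_zero (hD0 : D (e 0) = 0)
    (hDS : ∀ i, i + 1 < p → D (e (i + 1)) = e i)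
    (n i : ℕ) (hin : i < n) (hip : i < p) : (D ^ n) (e i) = 0 := by
  obtain ⟨m, rfl⟩ : ∃ m, n = m + 1 + i := ⟨n - i - 1, by omega⟩
  have h := pow_apply_chain_add hDS i 0 (by omega)
  rw [zero_add] at h
  rw [pow_add, Module.End.mul_apply, h, pow_succ, Module.End.mul_apply, hD0, map_zero]

theorem pow_apply_chain_shift (hJ : ∀ i, J (e i) = e (i + 1)) (n i : ℕ) :
    (J ^ n) (e i) = e (i + n) := by
  induction n with
  | zero => simp
  | succ n ih => rw [pow_succ', Module.End.mul_apply, ih, hJ, add_assoc]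

/-- A single nilpotent Jordan block `D` of size `p`, with the opposite shift `J`, satisfies
`D ^ (p - j) * J ^ (p - j) + J ^ j * D ^ j = 1`. -/
theorem pow_mul_shift_add_shift_mul_pow (hD0 : D (e 0) = 0)
    (hDS : ∀ i, i + 1 < p → D (e (i + 1)) = e i) (hJ : ∀ i, J (e i) = e (i + 1))
    (hep : ∀ i, p ≤ i → e i = 0)
    (hext : ∀ f g : Module.End R V, (∀ i < p, f (e i) = g (e i)) → f = g)
    (j : ℕ) (hj : j ≤ p) : D ^ (p - j) * J ^ (p - j) + J ^ j * D ^ j = 1 := by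
  refine hext _ _ fun i hi => ?_
  simp only [LinearMap.add_apply, Module.End.mul_apply, Module.End.one_apply,
    pow_apply_chain_shift hJ]
  by_cases hij : i < j
  · rw [pow_apply_chain_eq_zero hD0 hDS j i hij hi, map_zero, add_zero,
      pow_apply_chain_add hDS _ _ (by omega)]
  · obtain ⟨l, rfl⟩ : ∃ l, i = l + j := ⟨i - j, by omega⟩
    rw [hep _ (by omega), map_zero, zero_add, pow_apply_chain_add hDS _ _ hi,
      pow_apply_chain_shift hJ]

end Chain

/-- If `a ^ m * b + c * a ^ j = 1` and `a ^ (j + m) = 0`, then on every module the kernel of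
`a ^ j` is the image of `a ^ m`. -/
theorem ker_pow_smul_eq_range {E M : Type*} [Semiring E] [AddCommMonoid M] [Module E M]
    {a b c : E} {j m : ℕ} (h : a ^ m * b + c * a ^ j = 1) (h0 : a ^ (j + m) = 0) :
    {x : M | a ^ j • x = 0} = Set.range (fun x : M => a ^ m • x) := by
  ext x
  constructor
  · intro hx
    refine ⟨b • x, ?_⟩
    have hx' : a ^ j • x = 0 := hx
    have := congrArg (· • x) h
    simpa only [add_smul, mul_smul, hx', smul_zero, add_zero, one_smul] using this
  · rintro ⟨y, rfl⟩
    change a ^ j • a ^ m • y = 0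
    rw [← mul_smul, ← pow_add, h0, zero_smul]

theorem truncX_pow_eq_zero (k : Type*) [Field k] {p i : ℕ} (h : p ≤ i) :
    truncX k p ^ i = 0 := by
  refine pow_eq_zero_of_le h ?_
  rw [truncX, ← map_pow, Ideal.Quotient.eq_zero_iff_mem]
  exact Ideal.subset_span rfl

theorem exists_basis_truncX_pow (k : Type*) [Field k] (p : ℕ) :
    ∃ b : Module.Basis (Fin p) k (TruncPoly k p), ∀ i : Fin p, b i = truncX k p ^ (i : ℕ) := by
  have hd : (AdjoinRoot.powerBasis' (monic_X_pow (R := k) p)).dim = p := by simp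
  have h : ∃ b : Module.Basis (Fin p) k (AdjoinRoot ((X : k[X]) ^ p)),
      ∀ i : Fin p, b i = AdjoinRoot.root ((X : k[X]) ^ p) ^ (i : ℕ) := by
    refine ⟨(AdjoinRoot.powerBasis' (monic_X_pow (R := k) p)).basis.reindex (finCongr hd),
      fun i => ?_⟩
    rw [Module.Basis.reindex_apply, PowerBasis.basis_eq_pow]
    simp
  exact h

/-- The chain `e i = (-1) ^ i x ^ i / i!`, along which `-d/dx` is the downward shift. -/
def truncDividedPow (k : Type*) [Field k] (p i : ℕ) : TruncPoly k p :=
  ((-1) ^ i * (i.factorial : k)⁻¹) • truncX k p ^ i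

/-- Every `p`-DG module over `(A, D)`, i.e. every module `M` over
`E = End_k(A)`, is acyclic: for every `1 ≤ j ≤ p-1`, the kernel of the
endomorphism of `M` given by the action of `D^j ∈ E` equals the image of the
endomorphism given by the action of `D^(p-j) ∈ E`. -/
theorem pDG_modules_acyclic
    (k : Type*) [Field k] (p : ℕ) [Fact p.Prime] [CharP k p]
    (D : Module.End k (TruncPoly k p))
    (hD : ∀ i : ℕ, i < p → D (truncX k p ^ i) = -((i : k) • truncX k p ^ (i - 1)))
    (M : Type*) [AddCommGroup M] [Module k M]
    [Module (Module.End k (TruncPoly k p)) M]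
    [IsScalarTower k (Module.End k (TruncPoly k p)) M] :
    ∀ j : ℕ, 1 ≤ j → j ≤ p - 1 →
      {m : M | (D ^ j) • m = 0} = Set.range (fun m : M => (D ^ (p - j)) • m) := by
  intro j _ hj
  have hp : p.Prime := Fact.out
  obtain ⟨b, hb⟩ := exists_basis_truncX_pow k p
  have hfac : ∀ i < p, (i.factorial : k) ≠ 0 := fun i hi h => by
    rw [CharP.cast_eq_zero_iff k p, hp.dvd_factorial] at h
    omega
  have hep : ∀ i, p ≤ i → truncDividedPow k p i = 0 := fun i hi => by
    rw [truncDividedPow, truncX_pow_eq_zero k hi, smul_zero]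
  have hD0 : D (truncDividedPow k p 0) = 0 := by
    rw [truncDividedPow, map_smul, hD 0 hp.pos]
    simp
  have hDS : ∀ i, i + 1 < p →
      D (truncDividedPow k p (i + 1)) = truncDividedPow k p i := fun i hi => by
    have h1 : ((i + 1 : ℕ) : k) ≠ 0 := fun h => hfac _ hi (by
      rw [Nat.factorial_succ, Nat.cast_mul, h, zero_mul])
    have h2 := hfac i (by omega)
    rw [truncDividedPow, truncDividedPow, map_smul, hD _ hi, ← neg_smul, smul_smul,
      Nat.factorial_succ, Nat.cast_mul, Nat.add_sub_cancel]
    congr 1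
    field_simp
    ring
  obtain ⟨J, hJb⟩ : ∃ J : Module.End k (TruncPoly k p), ∀ i < p,
      J (truncX k p ^ i) = (-((i + 1 : ℕ) : k)⁻¹) • truncX k p ^ (i + 1) :=
    ⟨b.constr k fun i => (-((i + 1 : ℕ) : k)⁻¹) • truncX k p ^ ((i : ℕ) + 1), fun i hi => by
      rw [← hb ⟨i, hi⟩, Module.Basis.constr_basis]⟩
  have hJ : ∀ i, J (truncDividedPow k p i) = truncDividedPow k p (i + 1) := fun i => by
    by_cases hi : i < p
    · rw [truncDividedPow, truncDividedPow, map_smul, hJb i hi, smul_smul,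
        Nat.factorial_succ, Nat.cast_mul, mul_inv]
      congr 1
      ring
    · rw [hep i (by omega), hep (i + 1) (by omega), map_zero]
  have hext : ∀ f g : Module.End k (TruncPoly k p),
      (∀ i < p, f (truncDividedPow k p i) = g (truncDividedPow k p i)) → f = g := by
    refine fun f g h => b.ext fun i => ?_
    have hi := h i i.2
    rw [truncDividedPow, map_smul, map_smul] at hi
    rw [hb]
    exact smul_right_injective _ (mul_ne_zero (pow_ne_zero _ (neg_ne_zero.2 one_ne_zero))
      (inv_ne_zero (hfac i i.2))) hi
  refine ker_pow_smul_eq_range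
    (pow_mul_shift_add_shift_mul_pow hD0 hDS hJ hep hext j (by omega)) ?_
  rw [Nat.add_sub_cancel' (by omega)]
  exact hext _ _ fun i hi => pow_apply_chain_eq_zero hD0 hDS p i hi hi
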